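/- For fixed t ∈ (0,1) and all sufficiently large d, the regularized incomplete beta function satisfies I_t((d+1)/2, 1/2) ≥ √(t/(1-t)) · (2/√π) · t^{d/2}/(d+2). -/

import Mathlib

open MeasureTheory Real Set

/-- Regularized incomplete beta function `I_x(a,b)`. -/
noncomputable def regIncBeta (x a b : ℝ) : ℝ :=
  (∫ s in (0:ℝ)..x, s ^ (a - 1) * (1 - s) ^ (b - 1)) /
    (Real.Gamma a * Real.Gamma b / Real.Gamma (a + b))

/-- Log-convexity of `Γ` at the midpoint of `x` and `x + 1`. -/
theorem sqrt_mul_Gamma_add_half_le {x : ℝ} (hx : 0 < x) :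
    √x * Real.Gamma (x + 1 / 2) ≤ Real.Gamma (x + 1) := by
  have h := Real.Gamma_mul_add_mul_le_rpow_Gamma_mul_rpow_Gamma hx (by linarith : 0 < x + 1)
    (by norm_num : (0:ℝ) < 1 / 2) (by norm_num : (0:ℝ) < 1 / 2) (by norm_num)
  rw [show (1 / 2 : ℝ) * x + 1 / 2 * (x + 1) = x + 1 / 2 by ring, ← Real.sqrt_eq_rpow,
    ← Real.sqrt_eq_rpow] at h
  have hG : 0 < Real.Gamma (x + 1) := Real.Gamma_pos_of_pos (by linarith)
  calc √x * Real.Gamma (x + 1 / 2)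
      ≤ √x * (√(Real.Gamma x) * √(Real.Gamma (x + 1))) := by gcongr
    _ = √(x * Real.Gamma x) * √(Real.Gamma (x + 1)) := by rw [Real.sqrt_mul hx.le]; ring
    _ = Real.Gamma (x + 1) := by rw [← Real.Gamma_add_one hx.ne', Real.mul_self_sqrt hG.le]

theorem rpow_div_le_integral_beta {t a b : ℝ} (ht0 : 0 ≤ t) (ht1 : t < 1) (ha : 1 ≤ a)
    (hb : b ≤ 1) :
    t ^ a / a ≤ ∫ s in (0:ℝ)..t, s ^ (a - 1) * (1 - s) ^ (b - 1) := by
  have h : ∫ s in (0:ℝ)..t, s ^ (a - 1) = t ^ a / a := by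
    rw [integral_rpow (Or.inl (by linarith)), sub_add_cancel, Real.zero_rpow (by linarith),
      sub_zero]
  rw [← h]
  have hc : ContinuousOn (fun s : ℝ => s ^ (a - 1)) (Set.uIcc 0 t) :=
    (Real.continuous_rpow_const (by linarith)).continuousOn
  refine intervalIntegral.integral_mono_on ht0 hc.intervalIntegrable
    (ContinuousOn.intervalIntegrable (hc.mul ?_)) fun s hs => ?_
  · refine ContinuousOn.rpow_const (by fun_prop) fun s hs => Or.inl ?_
    rw [Set.uIcc_of_le ht0] at hs
    linarith [hs.2]
  · exact le_mul_of_one_le_right (Real.rpow_nonneg hs.1 _)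
      (Real.one_le_rpow_of_pos_of_le_one_of_nonpos (by linarith [hs.2]) (by linarith [hs.1])
        (by linarith))

/-- For fixed `t ∈ (0,1)` and sufficiently large `d`,
`I_t((d+1)/2, 1/2) ≥ √(t/(1-t)) · (2/√π) · t^{d/2}/(d+2)`. -/
theorem regIncBeta_lower_bound
    (t : ℝ) (ht0 : 0 < t) (ht1 : t < 1) :
    ∃ D : ℕ, ∀ d : ℕ, D ≤ d →
      Real.sqrt (t / (1 - t)) * (2 / Real.sqrt π) * t ^ ((d : ℝ) / 2) / (d + 2) ≤
        regIncBeta t (((d : ℝ) + 1) / 2) (1 / 2) := by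
  obtain ⟨D, hD⟩ := exists_nat_ge (2 / (1 - t))
  refine ⟨max D 1, fun d hd => ?_⟩
  have hd1 : (1:ℝ) ≤ d := by exact_mod_cast (le_max_right _ _).trans hd
  have hdD : (D:ℝ) ≤ d := by exact_mod_cast (le_max_left _ _).trans hd
  have h1t : 0 < 1 - t := by linarith
  have hx : 1 / (1 - t) ≤ (d:ℝ) / 2 := by
    have h : 2 / (1 - t) = 2 * (1 / (1 - t)) := by ring
    linarith
  have hI := rpow_div_le_integral_beta (b := 1 / 2) ht0.le ht1
    (by linarith : 1 ≤ ((d:ℝ) + 1) / 2) (by norm_num)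
  have hG := sqrt_mul_Gamma_add_half_le (by linarith : 0 < (d:ℝ) / 2)
  rw [show (d:ℝ) / 2 + 1 / 2 = (d + 1) / 2 by ring] at hG
  have hpos : 0 < Real.Gamma (((d:ℝ) + 1) / 2) := Real.Gamma_pos_of_pos (by linarith)
  have hratio : √(1 / (1 - t)) ≤ Real.Gamma ((d:ℝ) / 2 + 1) / Real.Gamma (((d:ℝ) + 1) / 2) :=
    (Real.sqrt_le_sqrt hx).trans ((le_div_iff₀ hpos).2 hG)
  have htpow : √t * t ^ ((d:ℝ) / 2) = t ^ (((d:ℝ) + 1) / 2) := by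
    rw [Real.sqrt_eq_rpow, ← Real.rpow_add ht0]
    ring_nf
  rw [regIncBeta, Real.Gamma_one_half_eq,
    show ((d:ℝ) + 1) / 2 + 1 / 2 = d / 2 + 1 by ring]
  set I := ∫ s in (0:ℝ)..t, s ^ (((d:ℝ) + 1) / 2 - 1) * (1 - s) ^ ((1 / 2 : ℝ) - 1)
  calc √(t / (1 - t)) * (2 / √π) * t ^ ((d : ℝ) / 2) / (d + 2)
      = √(1 / (1 - t)) * (t ^ (((d:ℝ) + 1) / 2) / ((d + 2) / 2)) / √π := by
        rw [← htpow, div_eq_mul_one_div t, Real.sqrt_mul ht0.le]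
        field_simp
    _ ≤ Real.Gamma ((d:ℝ) / 2 + 1) / Real.Gamma (((d:ℝ) + 1) / 2) * I / √π := by
        have hle : t ^ (((d:ℝ) + 1) / 2) / ((d + 2) / 2) ≤ I := by
          refine le_trans ?_ hI
          gcongr
          norm_num
        gcongr
    _ = I / (Real.Gamma (((d:ℝ) + 1) / 2) * √π / Real.Gamma ((d:ℝ) / 2 + 1)) := by
        field_simp
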